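/- The global solution on ℝ² of the PDE ∑_{i,j=1}^{2} f^{ij} ∂²/∂x_i∂x_j [ln det(f_kl)] = 0 is not unique: both f(x₁,x₂) = x₁² + x₂² and h(x₁,x₂) = e^{x₁} + x₂² are smooth, strictly convex on all of ℝ² and satisfy this PDE, and h is not a quadratic polynomial. -/

import Mathlib

open Real Filter Topology Matrix

noncomputable section

/-- The `i`-th partial derivative of `f`. -/
def pd {n : ℕ} (i : Fin n) (f : (Fin n → ℝ) → ℝ) : (Fin n → ℝ) → ℝ :=
  fun x => fderiv ℝ f x (Pi.single i 1)

/-- The Hessian matrix `(∂²f/∂x_i∂x_j)` of `f` at `x`. -/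
def hess {n : ℕ} (f : (Fin n → ℝ) → ℝ) (x : Fin n → ℝ) : Matrix (Fin n) (Fin n) ℝ :=
  Matrix.of fun i j => pd i (pd j f) x

/-- The gradient vector of `f` at `x`. -/
def gradv {n : ℕ} (f : (Fin n → ℝ) → ℝ) (x : Fin n → ℝ) : Fin n → ℝ :=
  fun i => pd i f x

/-- `ρ := (det (f_ij))^(-1/(n+2))`. -/
def rho {n : ℕ} (f : (Fin n → ℝ) → ℝ) (x : Fin n → ℝ) : ℝ :=
  (hess f x).det ^ (-(1 : ℝ) / ((n : ℝ) + 2))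

/-- The squared norm `‖grad h‖² = ∑ f^{ij} h_i h_j` with respect to the Calabi metric of `f`. -/
def gradSq {n : ℕ} (f h : (Fin n → ℝ) → ℝ) (x : Fin n → ℝ) : ℝ :=
  ∑ i, ∑ j, (hess f x)⁻¹ i j * pd i h x * pd j h x

/-- The Laplacian `Δh = (1/√det)(∑ ∂_i(√det · f^{ij} ∂_j h))` with respect to the
Calabi metric of `f`. -/
def calabiLap {n : ℕ} (f h : (Fin n → ℝ) → ℝ) (x : Fin n → ℝ) : ℝ :=
  (Real.sqrt (hess f x).det)⁻¹ *
    ∑ i, ∑ j, pd i (fun y => Real.sqrt (hess f y).det * (hess f y)⁻¹ i j * pd j h y) x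

/-- `Φ := ‖grad ρ‖²/ρ²`. -/
def Phi {n : ℕ} (f : (Fin n → ℝ) → ℝ) (x : Fin n → ℝ) : ℝ :=
  gradSq f (rho f) x / (rho f x) ^ 2

/-- PDE (1.2): `Δρ = -β ‖grad ρ‖²/ρ` on `Ω`. -/
def PDE2 {n : ℕ} (f : (Fin n → ℝ) → ℝ) (β : ℝ) (Ω : Set (Fin n → ℝ)) : Prop :=
  ∀ x ∈ Ω, calabiLap f (rho f) x = -β * gradSq f (rho f) x / rho f x

/-- The cofactor matrix of a square matrix. -/
def cof {n : ℕ} (H : Matrix (Fin n) (Fin n) ℝ) : Matrix (Fin n) (Fin n) ℝ :=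
  (Matrix.adjugate H)ᵀ

/-- PDE (1.1): `∑ F^{ij} w_ij = 0` with `w = (det (f_ij))^a` on `Ω`, where `(F^{ij})`
is the cofactor matrix of the Hessian of `f`. -/
def PDE1 {n : ℕ} (f : (Fin n → ℝ) → ℝ) (a : ℝ) (Ω : Set (Fin n → ℝ)) : Prop :=
  ∀ x ∈ Ω, ∑ i, ∑ j,
    cof (hess f x) i j * pd i (pd j fun y => (hess f y).det ^ a) x = 0

/-- `f` is a quadratic polynomial on `ℝ²`. -/
def IsQuadratic (f : (Fin 2 → ℝ) → ℝ) : Prop :=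
  ∃ (Q : Matrix (Fin 2) (Fin 2) ℝ) (b : Fin 2 → ℝ) (c : ℝ),
    ∀ x, f x = (∑ i, ∑ j, Q i j * x i * x j) + (∑ i, b i * x i) + c

/-- Euclidean open ball of radius `r` centered at `0` in `ℝ²`. -/
def ebal (r : ℝ) : Set (Fin 2 → ℝ) := {x | (x 0) ^ 2 + (x 1) ^ 2 < r ^ 2}

/-- Euclidean norm on `ℝ²`. -/
def enorm2 (x : Fin 2 → ℝ) : ℝ := Real.sqrt ((x 0) ^ 2 + (x 1) ^ 2)

/-- A normalized convex domain: `B_{2^{-3/2}}(0) ⊆ Ω ⊆ B_1(0)`. -/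
def NormalizedDomain (Ω : Set (Fin 2 → ℝ)) : Prop :=
  IsOpen Ω ∧ Convex ℝ Ω ∧ ebal ((2 : ℝ) ^ (-(3 : ℝ) / 2)) ⊆ Ω ∧ Ω ⊆ ebal 1

/-- The class `𝒮(Ω,C)`: smooth strictly convex functions on `Ω` with `inf f = 0` and
`f = C` on `∂Ω`. -/
def SClass (Ω : Set (Fin 2 → ℝ)) (C : ℝ) (f : (Fin 2 → ℝ) → ℝ) : Prop :=
  ContDiffOn ℝ (⊤ : ℕ∞) f Ω ∧ (∀ x ∈ Ω, (hess f x).PosDef) ∧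
    sInf (f '' Ω) = 0 ∧ ContinuousOn f (closure Ω) ∧ ∀ x ∈ frontier Ω, f x = C

/-- `u` is the Legendre transform function of `f` relative to `0`:
`u(∇f(x)) = ⟨x, ∇f(x)⟩ - f(x)`. -/
def LegendreOf (Ω : Set (Fin 2 → ℝ)) (f u : (Fin 2 → ℝ) → ℝ) : Prop :=
  ∀ x ∈ Ω, u (gradv f x) = (∑ i, x i * gradv f x i) - f x

end

/-- Partial derivatives of a separable function. -/
theorem pd_sep (a b a' b' : ℝ → ℝ) (ha : ∀ t, HasDerivAt a (a' t) t)
    (hb : ∀ t, HasDerivAt b (b' t) t) (i : Fin 2) :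
    pd i (fun x : Fin 2 → ℝ => a (x 0) + b (x 1)) =
      fun x => if i = 0 then a' (x 0) else b' (x 1) := by
  funext x
  have h0 : HasFDerivAt (fun x : Fin 2 → ℝ => x 0)
      (ContinuousLinearMap.proj (R := ℝ) (φ := fun _ : Fin 2 => ℝ) 0) x :=
    (ContinuousLinearMap.proj (R := ℝ) (φ := fun _ : Fin 2 => ℝ) 0).hasFDerivAt
  have h1 : HasFDerivAt (fun x : Fin 2 → ℝ => x 1)
      (ContinuousLinearMap.proj (R := ℝ) (φ := fun _ : Fin 2 => ℝ) 1) x :=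
    (ContinuousLinearMap.proj (R := ℝ) (φ := fun _ : Fin 2 => ℝ) 1).hasFDerivAt
  have hA := (ha (x 0)).comp_hasFDerivAt x h0
  have hB := (hb (x 1)).comp_hasFDerivAt x h1
  have hAB := (hA.add hB).fderiv
  have e : fderiv ℝ (fun x : Fin 2 → ℝ => a (x 0) + b (x 1)) x = _ := hAB
  unfold pd
  rw [e]
  fin_cases i <;> simp

theorem pd_sep_zero (a a' : ℝ → ℝ) (ha : ∀ t, HasDerivAt a (a' t) t) (i : Fin 2) :
    pd i (fun x : Fin 2 → ℝ => a (x 0)) = fun x => if i = 0 then a' (x 0) else 0 := by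
  have := pd_sep a (fun _ => 0) a' (fun _ => 0) ha (fun t => hasDerivAt_const t 0) i
  simpa using this

theorem pd_sep_one (b b' : ℝ → ℝ) (hb : ∀ t, HasDerivAt b (b' t) t) (i : Fin 2) :
    pd i (fun x : Fin 2 → ℝ => b (x 1)) = fun x => if i = 0 then 0 else b' (x 1) := by
  have := pd_sep (fun _ => 0) b (fun _ => 0) b' (fun t => hasDerivAt_const t 0) hb i
  simpa using this

theorem hess_sep (a b a' b' a'' b'' : ℝ → ℝ) (ha : ∀ t, HasDerivAt a (a' t) t)
    (hb : ∀ t, HasDerivAt b (b' t) t) (ha' : ∀ t, HasDerivAt a' (a'' t) t)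
    (hb' : ∀ t, HasDerivAt b' (b'' t) t) (x : Fin 2 → ℝ) :
    hess (fun x : Fin 2 → ℝ => a (x 0) + b (x 1)) x =
      Matrix.diagonal ![a'' (x 0), b'' (x 1)] := by
  ext i j
  simp only [hess, Matrix.of_apply]
  rw [pd_sep a b a' b' ha hb j]
  fin_cases j
  · have := pd_sep_zero a' a'' ha' i
    simp only [Fin.zero_eta, if_true]
    rw [this]
    fin_cases i <;> simp
  · have := pd_sep_one b' b'' hb' i
    simp only [Fin.mk_one, one_ne_zero, if_false]
    rw [this]
    fin_cases i <;> simp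

theorem sq_deriv (t : ℝ) : HasDerivAt (fun t : ℝ => t ^ 2) (2 * t) t := by
  simpa using hasDerivAt_pow 2 t

theorem two_mul_deriv (t : ℝ) : HasDerivAt (fun t : ℝ => 2 * t) 2 t := by
  simpa using (hasDerivAt_id t).const_mul 2

theorem hess_f (x : Fin 2 → ℝ) :
    hess (fun x : Fin 2 → ℝ => (x 0) ^ 2 + (x 1) ^ 2) x = Matrix.diagonal ![2, 2] :=
  hess_sep (fun t => t ^ 2) (fun t => t ^ 2) (fun t => 2 * t) (fun t => 2 * t)
    (fun _ => 2) (fun _ => 2) sq_deriv sq_deriv two_mul_deriv two_mul_deriv x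

theorem hess_h (x : Fin 2 → ℝ) :
    hess (fun x : Fin 2 → ℝ => Real.exp (x 0) + (x 1) ^ 2) x =
      Matrix.diagonal ![Real.exp (x 0), 2] :=
  hess_sep Real.exp (fun t => t ^ 2) Real.exp (fun t => 2 * t)
    Real.exp (fun _ => 2) Real.hasDerivAt_exp sq_deriv Real.hasDerivAt_exp two_mul_deriv x

theorem pd_const (c : ℝ) (i : Fin 2) : pd i (fun _ : Fin 2 → ℝ => c) = fun _ => 0 := by
  funext x
  simp [pd]

/-- non-uniqueness of global solutions of
`∑ f^{ij} ∂²/∂x_i∂x_j (ln det(f_kl)) = 0` on `ℝ²`: both `x₁² + x₂²` and `e^{x₁} + x₂²`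
are smooth, strictly convex global solutions, and the latter is not a quadratic
polynomial. -/
theorem statement5 :
    ∃ f h : (Fin 2 → ℝ) → ℝ,
      (∀ x, f x = (x 0) ^ 2 + (x 1) ^ 2) ∧
      (∀ x, h x = Real.exp (x 0) + (x 1) ^ 2) ∧
      ContDiff ℝ (⊤ : ℕ∞) f ∧ ContDiff ℝ (⊤ : ℕ∞) h ∧
      (∀ x, (hess f x).PosDef) ∧ (∀ x, (hess h x).PosDef) ∧
      (∀ x : Fin 2 → ℝ, ∑ i, ∑ j, (hess f x)⁻¹ i j *
          pd i (pd j fun y => Real.log (hess f y).det) x = 0) ∧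
      (∀ x : Fin 2 → ℝ, ∑ i, ∑ j, (hess h x)⁻¹ i j *
          pd i (pd j fun y => Real.log (hess h y).det) x = 0) ∧
      ¬ IsQuadratic h := by
  refine ⟨fun x => (x 0) ^ 2 + (x 1) ^ 2, fun x => Real.exp (x 0) + (x 1) ^ 2,
    fun _ => rfl, fun _ => rfl, by fun_prop, by fun_prop, ?_, ?_, ?_, ?_, ?_⟩
  · intro x
    rw [hess_f]
    refine Matrix.PosDef.diagonal fun i => ?_
    fin_cases i <;> simp
  · intro x
    rw [hess_h]
    refine Matrix.PosDef.diagonal fun i => ?_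
    fin_cases i <;> simp [Real.exp_pos]
  · intro x
    simp only [hess_f, pd_const, mul_zero, Finset.sum_const_zero]
  · intro x
    have e : (fun y : Fin 2 → ℝ => Real.log
        (hess (fun x : Fin 2 → ℝ => Real.exp (x 0) + (x 1) ^ 2) y).det) =
        fun y => y 0 + Real.log 2 := by
      funext y
      rw [hess_h, Matrix.det_diagonal]
      simp [Fin.prod_univ_two, Real.log_mul (Real.exp_ne_zero _)]
    rw [e]
    have e2 : ∀ j : Fin 2, pd j (fun y : Fin 2 → ℝ => y 0 + Real.log 2) =
        fun _ => if j = 0 then 1 else 0 := fun j =>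
      pd_sep (fun t => t) (fun _ => Real.log 2) (fun _ => 1) (fun _ => 0)
        (fun t => hasDerivAt_id t) (fun t => hasDerivAt_const t _) j
    simp only [e2, pd_const, mul_zero, Finset.sum_const_zero]
  · rintro ⟨Q, b, c, hq⟩
    have h0 := hq ![0, 0]
    have h1 := hq ![1, 0]
    have h2 := hq ![2, 0]
    have h3 := hq ![3, 0]
    simp [Fin.sum_univ_two] at h0 h1 h2 h3
    have e2 : Real.exp 2 = Real.exp 1 ^ 2 := by rw [← Real.exp_nat_mul]; norm_num
    have e3 : Real.exp 3 = Real.exp 1 ^ 3 := by rw [← Real.exp_nat_mul]; norm_num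
    rw [e2] at h2
    rw [e3] at h3
    have hz : (Real.exp 1 - 1) ^ 3 = 0 := by linarith
    have hz' := pow_eq_zero_iff (three_ne_zero) |>.1 hz
    have := Real.add_one_lt_exp (one_ne_zero)
    linarith
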